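/- Let A ⊆ ℂ⁴ be open and let μ : A → ℂ be holomorphic, satisfying on A the equations ∂μ/∂z̃₁ − μ·∂μ/∂z₂ = 0 and ∂μ/∂z̃₂ + μ·∂μ/∂z₁ = 0 (the equations of a holomorphic foliation by α-planes). Then μ satisfies the complex Laplace equation Σᵢ₌₀³ ∂²μ/∂xᵢ² = 0 and the complex horizontal weak conformality condition Σᵢ₌₀³ (∂μ/∂xᵢ)² = 0 on A; that is, μ is a complex-harmonic morphism. -/

import Mathlib

open Complex

/-- Complex directional derivative in the `i`-th coordinate direction of a map `ℂ⁴ → ℂ`. -/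
noncomputable def cd (f : (Fin 4 → ℂ) → ℂ) (i : Fin 4) (x : Fin 4 → ℂ) : ℂ :=
  fderiv ℂ f x (Pi.single i 1)

/-- `∂/∂z₁ = ½(∂/∂x₀ − i ∂/∂x₁)`. -/
noncomputable def dz1 (f : (Fin 4 → ℂ) → ℂ) (x : Fin 4 → ℂ) : ℂ :=
  (cd f 0 x - Complex.I * cd f 1 x) / 2

/-- `∂/∂z̃₁ = ½(∂/∂x₀ + i ∂/∂x₁)`. -/
noncomputable def dz1t (f : (Fin 4 → ℂ) → ℂ) (x : Fin 4 → ℂ) : ℂ :=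
  (cd f 0 x + Complex.I * cd f 1 x) / 2

/-- `∂/∂z₂ = ½(∂/∂x₂ − i ∂/∂x₃)`. -/
noncomputable def dz2 (f : (Fin 4 → ℂ) → ℂ) (x : Fin 4 → ℂ) : ℂ :=
  (cd f 2 x - Complex.I * cd f 3 x) / 2

/-- `∂/∂z̃₂ = ½(∂/∂x₂ + i ∂/∂x₃)`. -/
noncomputable def dz2t (f : (Fin 4 → ℂ) → ℂ) (x : Fin 4 → ℂ) : ℂ :=
  (cd f 2 x + Complex.I * cd f 3 x) / 2

open Set Metric Filter Topology MeasureTheory in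
/-- Each directional derivative of a holomorphic function on an open subset of a finite-dimensional
complex vector space is holomorphic. -/
theorem differentiableOn_fderiv_apply {E : Type*} [NormedAddCommGroup E] [NormedSpace ℂ E]
    [FiniteDimensional ℂ E] {s : Set E} (hs : IsOpen s) {f : E → ℂ}
    (hf : DifferentiableOn ℂ f s) (v : E) :
    DifferentiableOn ℂ (fun y => fderiv ℂ f y v) s := by
  intro x hx
  refine DifferentiableAt.differentiableWithinAt ?_
  let _ : MeasurableSpace E := borel E
  have _ : BorelSpace E := ⟨rfl⟩
  have hfx := (hf.differentiableAt (hs.mem_nhds hx)).continuousAt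
  have hev : ∀ᶠ y in 𝓝 x, y ∈ s ∧ dist (f y) (f x) < 1 :=
    (hs.eventually_mem hx).and (hfx.eventually (ball_mem_nhds _ one_pos))
  obtain ⟨ε, hε, hball⟩ := Metric.eventually_nhds_iff.1 hev
  obtain ⟨R, hR, hRε⟩ : ∃ R : ℝ, 0 < R ∧ 3 * R = ε := ⟨ε / 3, by positivity, by ring⟩
  have hdiff : ∀ y ∈ ball x (2 * R), DifferentiableAt ℂ f y := fun y hy =>
    hf.differentiableAt (hs.mem_nhds (hball (by rw [mem_ball] at hy; linarith)).1)
  have hbound : ∀ y ∈ ball x (2 * R), ‖fderiv ℂ f y‖₊ ≤ Real.toNNReal (2 / R) := by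
    intro y hy
    rw [mem_ball] at hy
    have hsub : ∀ z ∈ ball y R, dist z x < ε := fun z hz => by
      rw [mem_ball] at hz
      linarith [dist_triangle z y x]
    refine NNReal.coe_le_coe.1 ?_
    rw [coe_nnnorm, Real.coe_toNNReal _ (by positivity)]
    refine Complex.norm_fderiv_le_div_of_mapsTo_ball
      (fun z hz => (hf z (hball (hsub z hz)).1).mono fun w hw => (hball (hsub w hw)).1) ?_ hR
    intro z hz
    rw [mem_closedBall]
    have h1 := (hball (hsub z hz)).2
    have h2 := (hball (show dist y x < ε by linarith)).2
    linarith [dist_triangle_right (f z) (f y) (f x)]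
  have hlip : LipschitzOnWith (Real.toNNReal (2 / R)) f (ball x (2 * R)) := by
    let _ : NormedSpace ℝ E := NormedSpace.restrictScalars ℝ ℂ E
    exact (convex_ball x (2 * R)).lipschitzOnWith_of_nnnorm_fderiv_le hdiff hbound
  obtain ⟨ρ, hρ, hρv⟩ : ∃ ρ : ℝ, 0 < ρ ∧ ρ * ‖v‖ < R := by
    refine ⟨R / (‖v‖ + 1), by positivity, ?_⟩
    rw [div_mul_eq_mul_div, div_lt_iff₀ (by positivity)]
    nlinarith
  have hmem : ∀ y ∈ ball x R, ∀ ζ : ℂ, ‖ζ‖ ≤ ρ → y + ζ • v ∈ ball x (2 * R) := by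
    intro y hy ζ hζ
    rw [mem_ball, dist_eq_norm] at hy ⊢
    calc ‖y + ζ • v - x‖ = ‖(y - x) + ζ • v‖ := by congr 1; abel
      _ ≤ ‖y - x‖ + ‖ζ‖ * ‖v‖ := (norm_add_le _ _).trans_eq (by rw [norm_smul])
      _ ≤ ‖y - x‖ + ρ * ‖v‖ := by gcongr
      _ < 2 * R := by linarith
  have hcirc : ∀ θ, ‖circleMap 0 ρ θ‖ ≤ ρ := fun θ => by simp [abs_of_pos hρ]
  let w : ℝ → ℂ := fun θ => deriv (circleMap 0 ρ) θ * (1 / (circleMap 0 ρ θ) ^ 2)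
  have hw : Continuous w := by
    have h0 : ∀ θ, circleMap 0 ρ θ ^ 2 ≠ 0 := fun θ =>
      pow_ne_zero _ (circleMap_ne_center hρ.ne')
    simp only [w, deriv_circleMap]
    fun_prop (disch := exact h0)
  have hcont : ∀ y ∈ ball x R, Continuous fun θ : ℝ => w θ * f (y + circleMap 0 ρ θ • v) :=
    fun y hy => hw.mul <| continuous_iff_continuousAt.2 fun θ =>
      ContinuousAt.comp (g := f) (hdiff _ (hmem y hy _ (hcirc θ))).continuousAt
        (by fun_prop)
  have key : ∀ y ∈ ball x R, fderiv ℂ f y v =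
      (2 * Real.pi * I)⁻¹ * ∫ θ in (0 : ℝ)..2 * Real.pi, w θ * f (y + circleMap 0 ρ θ • v) := by
    intro y hy
    have hline : ∀ ζ : ℂ, HasDerivAt (fun ζ : ℂ => y + ζ • v) v ζ := fun ζ => by
      simpa using ((hasDerivAt_id ζ).smul_const v).const_add y
    have hd : DifferentiableOn ℂ (fun ζ : ℂ => f (y + ζ • v)) (closedBall 0 ρ) := fun ζ hζ =>
      ((hdiff _ (hmem y hy ζ (by simpa using hζ))).comp ζ
        (hline ζ).differentiableAt).differentiableWithinAt
    have h := hd.deriv_eq_smul_circleIntegral hρ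
    have hderiv : deriv (fun ζ : ℂ => f (y + ζ • v)) 0 = fderiv ℂ f y v := by
      have hy' : HasFDerivAt f (fderiv ℂ f y) (y + (0 : ℂ) • v) := by
        simpa using (hdiff y (by simpa using hmem y hy 0 (by simpa using hρ.le))).hasFDerivAt
      exact (hy'.comp_hasDerivAt (0 : ℂ) (hline 0)).deriv
    rw [hderiv, circleIntegral] at h
    rw [eq_inv_mul_iff_mul_eq₀ Complex.two_pi_I_ne_zero, ← smul_eq_mul, ← h]
    simp only [w, smul_eq_mul, sub_zero, mul_assoc]
  have hx0 : x ∈ ball x R := mem_ball_self hR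
  have hint := (intervalIntegral.hasFDerivAt_integral_of_dominated_loc_of_lip
    (μ := volume) (a := 0) (b := 2 * Real.pi)
    (F := fun y θ => w θ * f (y + circleMap 0 ρ θ • v))
    (F' := fun θ => w θ • fderiv ℂ f (x + circleMap 0 ρ θ • v))
    (bound := fun θ => ‖w θ‖ * (2 / R)) (ball_mem_nhds x hR)
    (by
      filter_upwards [ball_mem_nhds x hR] with y hy
      exact (hcont y hy).aestronglyMeasurable)
    ((hcont x hx0).intervalIntegrable _ _)
    (by
      have h : Measurable fun θ : ℝ => fderiv ℂ f (x + circleMap 0 ρ θ • v) :=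
        (measurable_fderiv ℂ f).comp
          (show Continuous fun θ : ℝ => x + circleMap 0 ρ θ • v by fun_prop).measurable
      have _ : SecondCountableTopology (E →L[ℂ] ℂ) := by
        have : FiniteDimensional ℂ (E →L[ℂ] ℂ) := inferInstance
        have : ProperSpace (E →L[ℂ] ℂ) := FiniteDimensional.proper ℂ _
        infer_instance
      exact (hw.aestronglyMeasurable).smul h.stronglyMeasurable.aestronglyMeasurable)
    (by
      refine Eventually.of_forall fun θ _ => LipschitzOnWith.of_dist_le_mul fun y hy z hz => ?_
      have h := hlip.dist_le_mul _ (hmem y hy _ (hcirc θ)) _ (hmem z hz _ (hcirc θ))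
      rw [Real.coe_toNNReal _ (by positivity), dist_add_right] at h
      rw [Real.coe_nnabs, abs_of_nonneg (by positivity), dist_eq_norm, ← mul_sub, norm_mul,
        mul_assoc, ← dist_eq_norm]
      gcongr)
    ((hw.norm.mul continuous_const).intervalIntegrable _ _)
    (by
      refine Eventually.of_forall fun θ _ => ?_
      have h := (hdiff _ (hmem x hx0 _ (hcirc θ))).hasFDerivAt.comp x
        ((hasFDerivAt_id x).add_const (circleMap 0 ρ θ • v))
      exact h.const_mul (w θ))).2
  refine (hint.differentiableAt.const_mul (2 * Real.pi * I)⁻¹).congr_of_eventuallyEq ?_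
  filter_upwards [ball_mem_nhds x hR] with y hy using key y hy

/-- A family of continuous linear maps on a finite-dimensional space is differentiable at a point if
all its applications are. -/
theorem differentiableAt_clm_of_apply {𝕜 D E F : Type*} [NontriviallyNormedField 𝕜]
    [CompleteSpace 𝕜] [NormedAddCommGroup D] [NormedSpace 𝕜 D] [NormedAddCommGroup E]
    [NormedSpace 𝕜 E] [FiniteDimensional 𝕜 E] [NormedAddCommGroup F] [NormedSpace 𝕜 F]
    {f : D → E →L[𝕜] F} {x : D} (h : ∀ v, DifferentiableAt 𝕜 (fun y => f y v) x) :
    DifferentiableAt 𝕜 f x := by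
  let e₁ := ContinuousLinearEquiv.ofFinrankEq
    (Module.finrank_fin_fun 𝕜 (n := Module.finrank 𝕜 E)).symm
  let e₂ := (e₁.arrowCongr (1 : F ≃L[𝕜] F)).trans
    (ContinuousLinearEquiv.piRing (Fin (Module.finrank 𝕜 E)))
  rw [← e₂.comp_differentiableAt_iff]
  exact differentiableAt_pi.2 fun i => h _

/-- Second directional derivatives of a holomorphic function on an open subset of a
finite-dimensional complex vector space commute. -/
theorem fderiv_fderiv_apply_comm {E : Type*} [NormedAddCommGroup E] [NormedSpace ℂ E]
    [FiniteDimensional ℂ E] {s : Set E} (hs : IsOpen s) {f : E → ℂ}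
    (hf : DifferentiableOn ℂ f s) {x : E} (hx : x ∈ s) (v w : E) :
    fderiv ℂ (fun y => fderiv ℂ f y v) x w = fderiv ℂ (fun y => fderiv ℂ f y w) x v := by
  have hd : ∀ u, DifferentiableAt ℂ (fun y => fderiv ℂ f y u) x := fun u =>
    (differentiableOn_fderiv_apply hs hf u).differentiableAt (hs.mem_nhds hx)
  have hF : DifferentiableAt ℂ (fderiv ℂ f) x := differentiableAt_clm_of_apply hd
  have happ : ∀ u z, fderiv ℂ (fun y => fderiv ℂ f y u) x z = fderiv ℂ (fderiv ℂ f) x z u := by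
    intro u z
    rw [fderiv_clm_apply hF (differentiableAt_const u)]
    simp
  rw [happ, happ]
  refine second_derivative_symmetric_of_eventually (f := f) ?_ hF.hasFDerivAt w v
  filter_upwards [hs.mem_nhds hx] with y hy
  exact (hf.differentiableAt (hs.mem_nhds hy)).hasFDerivAt

/-- a holomorphic solution of the α-plane foliation equations
`∂μ/∂z̃₁ − μ ∂μ/∂z₂ = 0`, `∂μ/∂z̃₂ + μ ∂μ/∂z₁ = 0` on an open subset of `ℂ⁴` is a
complex-harmonic morphism. -/
theorem alpha_plane_equations_give_complex_harmonic_morphism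
    (A : Set (Fin 4 → ℂ)) (hA : IsOpen A)
    (μ : (Fin 4 → ℂ) → ℂ)
    (hμ_hol : ∀ x ∈ A, DifferentiableAt ℂ μ x)
    (hμ_eq1 : ∀ x ∈ A, dz1t μ x - μ x * dz2 μ x = 0)
    (hμ_eq2 : ∀ x ∈ A, dz2t μ x + μ x * dz1 μ x = 0) :
    ∀ x ∈ A,
      (cd (cd μ 0) 0 x + cd (cd μ 1) 1 x + cd (cd μ 2) 2 x + cd (cd μ 3) 3 x = 0) ∧
      ((cd μ 0 x) ^ 2 + (cd μ 1 x) ^ 2 + (cd μ 2 x) ^ 2 + (cd μ 3 x) ^ 2 = 0) := by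
  have hd : DifferentiableOn ℂ μ A := fun x hx => (hμ_hol x hx).differentiableWithinAt
  have heq1 : ∀ y ∈ A, cd μ 0 y + I * cd μ 1 y = μ y * (cd μ 2 y - I * cd μ 3 y) := by
    intro y hy
    have h := hμ_eq1 y hy
    simp only [dz1t, dz2] at h
    linear_combination 2 * h
  have heq2 : ∀ y ∈ A, cd μ 2 y + I * cd μ 3 y = -(μ y * (cd μ 0 y - I * cd μ 1 y)) := by
    intro y hy
    have h := hμ_eq2 y hy
    simp only [dz2t, dz1] at h
    linear_combination 2 * h
  intro x hx
  have hI : I * I = -1 := I_mul_I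
  have hA' := hA.mem_nhds hx
  have hc : ∀ i, HasFDerivAt (cd μ i) (fderiv ℂ (cd μ i) x) x := fun i =>
    ((differentiableOn_fderiv_apply hA hd (Pi.single i 1)).differentiableAt hA').hasFDerivAt
  have hμ := (hμ_hol x hx).hasFDerivAt
  have hsymm : ∀ i j, cd (cd μ i) j x = cd (cd μ j) i x := fun i j =>
    fderiv_fderiv_apply_comm hA hd hx _ _
  have hdiff1 : ∀ j, cd (cd μ 0) j x + I * cd (cd μ 1) j x =
      μ x * (cd (cd μ 2) j x - I * cd (cd μ 3) j x) +
        cd μ j x * (cd μ 2 x - I * cd μ 3 x) := by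
    intro j
    have hL := (hc 0).add ((hc 1).const_mul I)
    have hR := hμ.mul ((hc 2).sub ((hc 3).const_mul I))
    have h := hL.unique (hR.congr_of_eventuallyEq (Filter.mem_of_superset hA' heq1))
    have h' := DFunLike.congr_fun h (Pi.single j 1)
    simp at h'
    simp only [cd] at h' ⊢
    linear_combination h'
  have hdiff2 : ∀ j, cd (cd μ 2) j x + I * cd (cd μ 3) j x =
      -(μ x * (cd (cd μ 0) j x - I * cd (cd μ 1) j x) +
        cd μ j x * (cd μ 0 x - I * cd μ 1 x)) := by
    intro j
    have hL := (hc 2).add ((hc 3).const_mul I)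
    have hR := (hμ.mul ((hc 0).sub ((hc 1).const_mul I))).neg
    have h := hL.unique (hR.congr_of_eventuallyEq (Filter.mem_of_superset hA' heq2))
    have h' := DFunLike.congr_fun h (Pi.single j 1)
    simp at h'
    simp only [cd] at h' ⊢
    linear_combination h'
  constructor
  · have h0 := hdiff1 0
    have h1 := hdiff1 1
    have h2 := hdiff2 2
    have h3 := hdiff2 3
    rw [hsymm 1 0, hsymm 2 0, hsymm 3 0] at h0
    rw [hsymm 2 1, hsymm 3 1] at h1
    rw [hsymm 3 2] at h2
    linear_combination h0 - I * h1 + h2 - I * h3 +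
      (cd (cd μ 1) 1 x + cd (cd μ 3) 3 x) * hI
  · linear_combination (cd μ 0 x - I * cd μ 1 x) * heq1 x hx +
      (cd μ 2 x - I * cd μ 3 x) * heq2 x hx +
      (cd μ 1 x ^ 2 + cd μ 3 x ^ 2) * hI
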